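/- Let α, ν ∈ ℝ and let Q be an admissible quantization of V_α of type (i)′ with parameter ν. Then Q(ℓ³ + 3αℓ²) = Q(ℓ)³ + 3α·Q(ℓ)² + (1/2)·Q(ℓ) + (α/2)·I as linear operators on D. -/

import Mathlib

noncomputable section

open Complex

/-- Partial derivative in the first (angle) variable. -/
def pdTheta (f : ℝ × ℝ → ℝ) : ℝ × ℝ → ℝ := fun p => deriv (fun t => f (t, p.2)) p.1

/-- Partial derivative in the second (momentum) variable. -/
def pdEll (f : ℝ × ℝ → ℝ) : ℝ × ℝ → ℝ := fun p => deriv (fun l => f (p.1, l)) p.2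

/-- Poisson bracket `{f,g} = f_ℓ g_θ − f_θ g_ℓ`. -/
def pb (f g : ℝ × ℝ → ℝ) : ℝ × ℝ → ℝ :=
  fun p => pdEll f p * pdTheta g p - pdTheta f p * pdEll g p

/-- Spanning set for the polynomial algebra `P`. -/
def PGens : Set (ℝ × ℝ → ℝ) :=
  {h | ∃ r m : ℕ, h = (fun p : ℝ × ℝ => p.2 ^ r * Real.sin (m * p.1)) ∨
       h = (fun p : ℝ × ℝ => p.2 ^ r * Real.cos (m * p.1))}

/-- The polynomial algebra `P`. -/
def P : Submodule ℝ (ℝ × ℝ → ℝ) := Submodule.span ℝ PGens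

def fone : ℝ × ℝ → ℝ := fun _ => 1
def fell : ℝ × ℝ → ℝ := fun p => p.2
def fsin : ℝ × ℝ → ℝ := fun p => Real.sin p.1
def fcos : ℝ × ℝ → ℝ := fun p => Real.cos p.1

lemma fone_mem_P : fone ∈ P :=
  Submodule.subset_span ⟨0, 0, Or.inr (by funext p; simp [fone])⟩

lemma fell_mem_P : fell ∈ P :=
  Submodule.subset_span ⟨1, 0, Or.inr (by funext p; simp [fell])⟩

lemma fsin_mem_P : fsin ∈ P :=
  Submodule.subset_span ⟨0, 1, Or.inl (by funext p; simp [fsin])⟩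

lemma fcos_mem_P : fcos ∈ P :=
  Submodule.subset_span ⟨0, 1, Or.inr (by funext p; simp [fcos])⟩

/-- The domain `D = C^∞(S¹,ℂ)`: smooth `2π`-periodic functions. -/
def Dom : Submodule ℂ (ℝ → ℂ) where
  carrier := {ψ | ContDiff ℝ (⊤ : ℕ∞) ψ ∧ ∀ t, ψ (t + 2 * Real.pi) = ψ t}
  add_mem' := by
    intro a b ha hb
    exact ⟨ha.1.add hb.1, fun t => by simp [Pi.add_apply, ha.2 t, hb.2 t]⟩
  zero_mem' := ⟨contDiff_const, fun t => rfl⟩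
  smul_mem' := by
    intro c a ha
    exact ⟨ha.1.const_smul c, fun t => by simp [Pi.smul_apply, ha.2 t]⟩

/-- The `L²` inner product on `D`. -/
def ip (φ ψ : ℝ → ℂ) : ℂ := ∫ t in (0:ℝ)..(2 * Real.pi), (starRingEnd ℂ) (φ t) * ψ t

/-- Symmetric operator on `D`. -/
def SymmetricOp (A : Dom →ₗ[ℂ] Dom) : Prop :=
  ∀ φ ψ : Dom, ip (A φ : ℝ → ℂ) (ψ : ℝ → ℂ) = ip (φ : ℝ → ℂ) (A ψ : ℝ → ℂ)

/-- An admissible quantization of type (i)′ with parameter ν of a Lie subalgebra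
`O ⊆ P` containing the basic set. -/
structure IsQuant (O : Submodule ℝ (ℝ × ℝ → ℝ)) (ν : ℝ)
    (Q : O →ₗ[ℝ] (Dom →ₗ[ℂ] Dom)) : Prop where
  map_bracket : ∀ (f g : O) (h : pb f g ∈ O),
    Q ⟨pb f g, h⟩ = Complex.I • (Q f ∘ₗ Q g - Q g ∘ₗ Q f)
  map_one : ∀ h : fone ∈ O, Q ⟨fone, h⟩ = LinearMap.id
  symm : ∀ f : O, SymmetricOp (Q f)
  map_ell : ∀ (h : fell ∈ O) (ψ : Dom) (t : ℝ),
    (Q ⟨fell, h⟩ ψ : ℝ → ℂ) t = -Complex.I * deriv (ψ : ℝ → ℂ) t + (ν : ℂ) * (ψ : ℝ → ℂ) t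
  map_sin : ∀ (h : fsin ∈ O) (ψ : Dom) (t : ℝ),
    (Q ⟨fsin, h⟩ ψ : ℝ → ℂ) t = (Real.sin t : ℂ) * (ψ : ℝ → ℂ) t
  map_cos : ∀ (h : fcos ∈ O) (ψ : Dom) (t : ℝ),
    (Q ⟨fcos, h⟩ ψ : ℝ → ℂ) t = (Real.cos t : ℂ) * (ψ : ℝ → ℂ) t

end
noncomputable section
/-- Partial θ-derivative of a complex-valued function. -/
def pdThetaC (f : ℝ × ℝ → ℂ) : ℝ × ℝ → ℂ := fun p => deriv (fun t => f (t, p.2)) p.1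
/-- Partial ℓ-derivative of a complex-valued function. -/
def pdEllC (f : ℝ × ℝ → ℂ) : ℝ × ℝ → ℂ := fun p => deriv (fun l => f (p.1, l)) p.2
/-- Poisson bracket of complex-valued functions. -/
def pbC (f g : ℝ × ℝ → ℂ) : ℝ × ℝ → ℂ :=
  fun p => pdEllC f p * pdThetaC g p - pdThetaC f p * pdEllC g p

/-- `e^r_m = ℓ^r e^{imθ}`. -/
def eC (r : ℕ) (m : ℤ) : ℝ × ℝ → ℂ :=
  fun p => (p.2 : ℂ) ^ r * Complex.exp (Complex.I * (m : ℂ) * (p.1 : ℂ))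

/-- The complexification `P_ℂ` of `P`. -/
def PC : Submodule ℂ (ℝ × ℝ → ℂ) :=
  Submodule.span ℂ {h | ∃ (r : ℕ) (m : ℤ), h = eC r m}

/-- Closure under the Poisson bracket (complex case). -/
def IsLieSubC (S : Submodule ℂ (ℝ × ℝ → ℂ)) : Prop :=
  ∀ f g : ℝ × ℝ → ℂ, f ∈ S → g ∈ S → pbC f g ∈ S

/-- The generators of `W_α`: `1, e^0_1, e^0_{−1}, e^1_0` and
`e^2_{2N+1} + 2α e^1_{2N+1}` for all `N ∈ ℤ`. -/
def WGens (α : ℝ) : Set (ℝ × ℝ → ℂ) :=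
  {fun _ => 1, eC 0 1, eC 0 (-1), eC 1 0} ∪
    {h | ∃ N : ℤ, h = eC 2 (2 * N + 1) + (2 * α : ℂ) • eC 1 (2 * N + 1)}

/-- `W_α`: the smallest complex Lie subalgebra of `P_ℂ` containing the generators. -/
def W (α : ℝ) : Submodule ℂ (ℝ × ℝ → ℂ) :=
  sInf {S | S ≤ PC ∧ WGens α ⊆ S ∧ IsLieSubC S}

/-- The complexification of a real-valued function. -/
def cplx (f : ℝ × ℝ → ℝ) : ℝ × ℝ → ℂ := fun p => (f p : ℂ)

/-- `V_α`: the real elements of `W_α`, a real Lie subalgebra of `P`. -/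
def V (α : ℝ) : Submodule ℝ (ℝ × ℝ → ℝ) where
  carrier := {f | cplx f ∈ W α}
  add_mem' := by
    intro a b ha hb
    simp only [Set.mem_setOf_eq] at *
    have h : cplx (a + b) = cplx a + cplx b := by
      funext p; simp [cplx]
    rw [h]; exact add_mem ha hb
  zero_mem' := by
    simp only [Set.mem_setOf_eq]
    have h : cplx (0 : ℝ × ℝ → ℝ) = 0 := by funext p; simp [cplx]
    rw [h]; exact zero_mem _
  smul_mem' := by
    intro c a ha
    simp only [Set.mem_setOf_eq] at *
    have h : cplx (c • a) = (c : ℂ) • cplx a := by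
      funext p; simp [cplx]
    rw [h]; exact Submodule.smul_mem _ _ ha
end
noncomputable section
lemma mem_W_of_mem_WGens {α : ℝ} {f : ℝ × ℝ → ℂ} (hf : f ∈ WGens α) : f ∈ W α := by
  rw [W, Submodule.mem_sInf]
  exact fun S hS => hS.2.1 hf

lemma fone_mem_V (α : ℝ) : fone ∈ V α := by
  show cplx fone ∈ W α
  have h : cplx fone = fun _ => (1 : ℂ) := by funext p; simp [cplx, fone]
  rw [h]
  exact mem_W_of_mem_WGens (Or.inl (by simp))

lemma fell_mem_V (α : ℝ) : fell ∈ V α := by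
  show cplx fell ∈ W α
  have h : cplx fell = eC 1 0 := by
    funext p; simp [cplx, fell, eC]
  rw [h]
  exact mem_W_of_mem_WGens (Or.inl (by simp [WGens]))

lemma fsin_mem_V (α : ℝ) : fsin ∈ V α := by
  show cplx fsin ∈ W α
  have h : cplx fsin = (Complex.I / 2) • eC 0 (-1) - (Complex.I / 2) • eC 0 1 := by
    funext p
    have h1 : Complex.I * (((1 : ℤ) : ℂ)) * (p.1 : ℂ) = (p.1 : ℂ) * Complex.I := by
      push_cast; ring
    have h2 : Complex.I * (((-1 : ℤ) : ℂ)) * (p.1 : ℂ) = -(p.1 : ℂ) * Complex.I := by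
      push_cast; ring
    simp only [cplx, fsin, eC, Pi.sub_apply, Pi.smul_apply, smul_eq_mul, pow_zero, one_mul,
      h1, h2, Complex.ofReal_sin]
    rw [Complex.sin]
    ring
  rw [h]
  exact sub_mem
    (Submodule.smul_mem _ _ (mem_W_of_mem_WGens (Or.inl (by simp [WGens]))))
    (Submodule.smul_mem _ _ (mem_W_of_mem_WGens (Or.inl (by simp [WGens]))))

lemma fcos_mem_V (α : ℝ) : fcos ∈ V α := by
  show cplx fcos ∈ W α
  have h : cplx fcos = ((1 : ℂ) / 2) • eC 0 1 + ((1 : ℂ) / 2) • eC 0 (-1) := by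
    funext p
    have h1 : Complex.I * (((1 : ℤ) : ℂ)) * (p.1 : ℂ) = (p.1 : ℂ) * Complex.I := by
      push_cast; ring
    have h2 : Complex.I * (((-1 : ℤ) : ℂ)) * (p.1 : ℂ) = -(p.1 : ℂ) * Complex.I := by
      push_cast; ring
    simp only [cplx, fcos, eC, Pi.add_apply, Pi.smul_apply, smul_eq_mul, pow_zero, one_mul,
      h1, h2, Complex.ofReal_cos]
    rw [Complex.cos]
    ring
  rw [h]
  exact add_mem
    (Submodule.smul_mem _ _ (mem_W_of_mem_WGens (Or.inl (by simp [WGens]))))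
    (Submodule.smul_mem _ _ (mem_W_of_mem_WGens (Or.inl (by simp [WGens]))))
end
noncomputable section
/-- `ℓ³ + 3αℓ²`. -/
def fcube (α : ℝ) : ℝ × ℝ → ℝ := fun p => p.2 ^ 3 + 3 * α * p.2 ^ 2

lemma aux_deriv_ofReal (f : ℝ → ℝ) (x : ℝ) :
    deriv (fun t => (f t : ℂ)) x = ((deriv f x : ℝ) : ℂ) := by
  by_cases h : DifferentiableAt ℝ f x
  · exact h.hasDerivAt.ofReal_comp.deriv
  · rw [deriv_zero_of_not_differentiableAt h, deriv_zero_of_not_differentiableAt]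
    · simp
    · intro h'
      apply h
      have := Complex.reCLM.differentiableAt.comp x h'
      simpa [Function.comp_def] using this

lemma aux_pb_cplx (f g : ℝ × ℝ → ℝ) : cplx (pb f g) = pbC (cplx f) (cplx g) := by
  funext p
  simp only [cplx, pb, pbC, pdEll, pdTheta, pdEllC, pdThetaC, aux_deriv_ofReal]
  push_cast
  rfl

lemma aux_pb_mem {α : ℝ} {f g : ℝ × ℝ → ℝ} (hf : f ∈ V α) (hg : g ∈ V α) : pb f g ∈ V α := by
  show cplx (pb f g) ∈ W α
  rw [aux_pb_cplx]
  have hf' : cplx f ∈ W α := hf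
  have hg' : cplx g ∈ W α := hg
  rw [W, Submodule.mem_sInf] at *
  exact fun S hS => hS.2.2 _ _ (hf' S hS) (hg' S hS)

def auxgc (α : ℝ) : ℝ × ℝ → ℝ := fun p => (p.2 ^ 2 + 2 * α * p.2) * Real.cos p.1
def auxgs (α : ℝ) : ℝ × ℝ → ℝ := fun p => (p.2 ^ 2 + 2 * α * p.2) * Real.sin p.1

lemma auxg_mem (α : ℝ) : auxgc α ∈ V α ∧ auxgs α ∈ V α := by
  have k1 : eC 2 1 + (2 * α : ℂ) • eC 1 1 ∈ W α :=
    mem_W_of_mem_WGens (Or.inr ⟨0, by norm_num⟩)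
  have k2 : eC 2 (-1) + (2 * α : ℂ) • eC 1 (-1) ∈ W α :=
    mem_W_of_mem_WGens (Or.inr ⟨-1, by norm_num⟩)
  constructor
  · show cplx (auxgc α) ∈ W α
    have h : cplx (auxgc α) = ((1 : ℂ) / 2) • (eC 2 1 + (2 * α : ℂ) • eC 1 1)
        + ((1 : ℂ) / 2) • (eC 2 (-1) + (2 * α : ℂ) • eC 1 (-1)) := by
      funext p
      have h1 : Complex.I * (((1 : ℤ) : ℂ)) * (p.1 : ℂ) = (p.1 : ℂ) * Complex.I := by
        push_cast; ring
      have h2 : Complex.I * (((-1 : ℤ) : ℂ)) * (p.1 : ℂ) = -(p.1 : ℂ) * Complex.I := by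
        push_cast; ring
      simp only [cplx, auxgc, eC, Pi.add_apply, Pi.smul_apply, smul_eq_mul,
        h1, h2]
      push_cast
      rw [Complex.cos]
      ring
    rw [h]
    exact add_mem (Submodule.smul_mem _ _ k1) (Submodule.smul_mem _ _ k2)
  · show cplx (auxgs α) ∈ W α
    have h : cplx (auxgs α) = (Complex.I / 2) • (eC 2 (-1) + (2 * α : ℂ) • eC 1 (-1))
        - (Complex.I / 2) • (eC 2 1 + (2 * α : ℂ) • eC 1 1) := by
      funext p
      have h1 : Complex.I * (((1 : ℤ) : ℂ)) * (p.1 : ℂ) = (p.1 : ℂ) * Complex.I := by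
        push_cast; ring
      have h2 : Complex.I * (((-1 : ℤ) : ℂ)) * (p.1 : ℂ) = -(p.1 : ℂ) * Complex.I := by
        push_cast; ring
      simp only [cplx, auxgs, eC, Pi.add_apply, Pi.sub_apply, Pi.smul_apply, smul_eq_mul,
        h1, h2]
      push_cast
      rw [Complex.sin]
      ring
    rw [h]
    exact sub_mem (Submodule.smul_mem _ _ k2) (Submodule.smul_mem _ _ k1)

/-- Compute a bracket of two products. -/
lemma aux_pb_prod (a b c d a' b' c' d' : ℝ → ℝ)
    (ha : ∀ x, HasDerivAt a (a' x) x) (hb : ∀ x, HasDerivAt b (b' x) x)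
    (hc : ∀ x, HasDerivAt c (c' x) x) (hd : ∀ x, HasDerivAt d (d' x) x) :
    pb (fun p => a p.2 * b p.1) (fun p => c p.2 * d p.1) =
      fun p => a' p.2 * b p.1 * (c p.2 * d' p.1) - a p.2 * b' p.1 * (c' p.2 * d p.1) := by
  funext p
  simp only [pb, pdEll, pdTheta]
  rw [((ha p.2).mul_const (b p.1)).deriv, ((hc p.2).mul_const (d p.1)).deriv,
    ((hb p.1).const_mul (a p.2)).deriv, ((hd p.1).const_mul (c p.2)).deriv]

lemma aux_d3 (α : ℝ) (x : ℝ) :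
    HasDerivAt (fun x : ℝ => x ^ 3 + 3 * α * x ^ 2) (3 * x ^ 2 + 6 * α * x) x := by
  have := (hasDerivAt_pow 3 x).add ((hasDerivAt_pow 2 x).const_mul (3 * α))
  refine HasDerivAt.congr_deriv this ?_
  norm_num; ring

lemma aux_d2 (α : ℝ) (x : ℝ) :
    HasDerivAt (fun x : ℝ => x ^ 2 + 2 * α * x) (2 * x + 2 * α) x := by
  have := (hasDerivAt_pow 2 x).add ((hasDerivAt_id x).const_mul (2 * α))
  refine HasDerivAt.congr_deriv this ?_
  norm_num

lemma aux_ms (x : ℝ) : HasDerivAt Real.cos ((fun x => - Real.sin x) x) x := Real.hasDerivAt_cos x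

lemma aux_b1 (α : ℝ) : pb (fcube α) fell = 0 := by
  have := aux_pb_prod (fun x : ℝ => x ^ 3 + 3 * α * x ^ 2) (fun _ => 1) (fun x => x) (fun _ => 1)
    _ (fun _ => 0) (fun _ => 1) (fun _ => 0) (aux_d3 α) (fun x => hasDerivAt_const x 1)
    (fun x => hasDerivAt_id x) (fun x => hasDerivAt_const x 1)
  simp only [mul_one] at this
  unfold fcube fell
  rw [this]; funext p; simp

lemma aux_b2 (α : ℝ) : pb (fcube α) fcos = (-3 : ℝ) • auxgs α := by
  have := aux_pb_prod (fun x : ℝ => x ^ 3 + 3 * α * x ^ 2) (fun _ => 1) (fun _ => 1) Real.cos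
    _ (fun _ => 0) (fun _ => 0) _ (aux_d3 α) (fun x => hasDerivAt_const x 1)
    (fun x => hasDerivAt_const x 1) aux_ms
  simp only [mul_one, one_mul] at this
  unfold fcube fcos
  rw [this]; funext p; simp [auxgs]; ring

lemma aux_b3 (α : ℝ) : pb (fcube α) fsin = (3 : ℝ) • auxgc α := by
  have := aux_pb_prod (fun x : ℝ => x ^ 3 + 3 * α * x ^ 2) (fun _ => 1) (fun _ => 1) Real.sin
    _ (fun _ => 0) (fun _ => 0) _ (aux_d3 α) (fun x => hasDerivAt_const x 1)
    (fun x => hasDerivAt_const x 1) Real.hasDerivAt_sin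
  simp only [mul_one, one_mul] at this
  unfold fcube fsin
  rw [this]; funext p; simp [auxgc]; ring

lemma aux_b4 (α : ℝ) : pb (auxgc α) fsin - pb (auxgs α) fcos
    = (2 : ℝ) • fell + (2 * α) • fone := by
  have h1 := aux_pb_prod (fun x : ℝ => x ^ 2 + 2 * α * x) Real.cos (fun _ => 1) Real.sin
    _ _ (fun _ => 0) _ (aux_d2 α) aux_ms
    (fun x => hasDerivAt_const x 1) Real.hasDerivAt_sin
  have h2 := aux_pb_prod (fun x : ℝ => x ^ 2 + 2 * α * x) Real.sin (fun _ => 1) Real.cos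
    _ _ (fun _ => 0) _ (aux_d2 α) Real.hasDerivAt_sin
    (fun x => hasDerivAt_const x 1) aux_ms
  simp only [one_mul] at h1 h2
  unfold auxgc auxgs fsin fcos
  rw [h1, h2]; funext p
  simp [fell, fone]
  linear_combination (2 * p.2 + 2 * α) * Real.sin_sq_add_cos_sq p.1

lemma aux_b5 (α : ℝ) : pb (auxgc α) (auxgs α)
    = (2 : ℝ) • fcube α + (4 * α ^ 2) • fell := by
  have h1 := aux_pb_prod (fun x : ℝ => x ^ 2 + 2 * α * x) Real.cos
    (fun x : ℝ => x ^ 2 + 2 * α * x) Real.sin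
    _ _ _ _ (aux_d2 α) aux_ms (aux_d2 α) Real.hasDerivAt_sin
  unfold auxgc auxgs
  rw [h1]; funext p
  simp [fell, fcube]
  linear_combination (2 * p.2 + 2 * α) * (p.2 ^ 2 + 2 * α * p.2) * Real.sin_sq_add_cos_sq p.1

/-- Fourier basis. -/
def auxe (n : ℤ) : Dom := ⟨fun t => Complex.exp (Complex.I * n * t), by
  constructor
  · have h : ContDiff ℝ (⊤ : ℕ∞) (fun t : ℝ => Complex.I * (n : ℂ) * (t : ℂ)) :=
      contDiff_const.mul Complex.ofRealCLM.contDiff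
    exact h.cexp
  · intro t
    have : Complex.I * (n : ℂ) * ((t + 2 * Real.pi : ℝ) : ℂ)
        = Complex.I * n * t + n * (2 * Real.pi * Complex.I) := by push_cast; ring
    show Complex.exp (Complex.I * n * ((t + 2 * Real.pi : ℝ) : ℂ)) = _
    rw [this, Complex.exp_add, Complex.exp_int_mul_two_pi_mul_I, mul_one]⟩

lemma auxe_apply (n : ℤ) (t : ℝ) : (auxe n : ℝ → ℂ) t = Complex.exp (Complex.I * n * t) := rfl

lemma auxe_hasDeriv (n : ℤ) (t : ℝ) :
    HasDerivAt (auxe n : ℝ → ℂ) (Complex.I * n * (auxe n : ℝ → ℂ) t) t := by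
  have h : HasDerivAt (fun t : ℝ => Complex.I * (n : ℂ) * (t : ℂ)) (Complex.I * n) t := by
    simpa using (Complex.ofRealCLM.hasDerivAt (x := t)).const_mul (Complex.I * (n : ℂ))
  have := h.cexp
  rw [auxe_apply, mul_comm]
  exact this

lemma aux_complete (ψ : Dom) (h : ∀ n, ip (auxe n : ℝ → ℂ) (ψ : ℝ → ℂ) = 0) : ψ = 0 := by
  have : Fact (0 < 2 * Real.pi) := ⟨Real.two_pi_pos⟩
  have hper : Function.Periodic (ψ : ℝ → ℂ) (2 * Real.pi) := ψ.2.2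
  have hc : Continuous (ψ : ℝ → ℂ) := ψ.2.1.continuous
  let g : C(AddCircle (2 * Real.pi), ℂ) := ⟨hper.lift, continuous_coinduced_dom.mpr hc⟩
  have hg : ∀ t : ℝ, g (t : AddCircle (2 * Real.pi)) = (ψ : ℝ → ℂ) t := fun t => hper.lift_coe t
  have hz : ∀ n, fourierCoeff g n = 0 := by
    intro n
    rw [fourierCoeff_eq_intervalIntegral _ n 0, zero_add]
    have := h n
    unfold ip at this
    rw [show (0 : ℂ) = (1 / (2 * Real.pi)) • (0 : ℂ) by simp, ← this]
    congr 1
    apply intervalIntegral.integral_congr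
    intro t _
    simp only [hg, smul_eq_mul, fourier_coe_apply, auxe_apply, ← Complex.exp_conj]
    congr 2
    simp
    field_simp
  have hs : Summable (fourierCoeff g) := by
    have : fourierCoeff g = 0 := funext hz
    rw [this]; exact summable_zero
  ext t
  have := has_pointwise_sum_fourier_series_of_summable hs (t : AddCircle (2 * Real.pi))
  simp only [hz, zero_smul] at this
  rw [← hg t, this.unique hasSum_zero]
  rfl

lemma aux_eigen (L A : Dom →ₗ[ℂ] Dom) (ν : ℝ)
    (hL : ∀ (ψ : Dom) (t : ℝ), (L ψ : ℝ → ℂ) t =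
      -Complex.I * deriv (ψ : ℝ → ℂ) t + (ν : ℂ) * (ψ : ℝ → ℂ) t)
    (hLe : ∀ n : ℤ, L (auxe n) = ((n : ℂ) + ν) • auxe n)
    (hc : ∀ ψ, A (L ψ) = L (A ψ)) (n : ℤ) : ∃ c : ℂ, A (auxe n) = c • auxe n := by
  set f := A (auxe n) with hf
  have h1 : L f = ((n : ℂ) + ν) • f := by rw [hf, ← hc, hLe, map_smul]
  have hd : ∀ t, deriv (f : ℝ → ℂ) t = Complex.I * n * (f : ℝ → ℂ) t := by
    intro t
    have h2 := hL f t
    rw [h1] at h2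
    simp only [Submodule.coe_smul, Pi.smul_apply, smul_eq_mul] at h2
    linear_combination (-Complex.I) * h2 + (deriv (f : ℝ → ℂ) t) * Complex.I_mul_I
  have hdiff : Differentiable ℝ (f : ℝ → ℂ) := f.2.1.differentiable (by simp)
  have hD : ∀ t, HasDerivAt (fun t => (f : ℝ → ℂ) t * (auxe (-n) : ℝ → ℂ) t) 0 t := by
    intro t
    refine HasDerivAt.congr_deriv ((hdiff t).hasDerivAt.mul (auxe_hasDeriv (-n) t)) ?_
    rw [hd]; push_cast; ring
  have hconst := is_const_of_deriv_eq_zero (fun t => (hD t).differentiableAt)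
    (fun t => (hD t).deriv)
  refine ⟨(f : ℝ → ℂ) 0, ?_⟩
  ext t
  have h0 := hconst t 0
  simp only [auxe_apply] at h0
  simp only [Submodule.coe_smul, Pi.smul_apply, smul_eq_mul, auxe_apply]
  have he : Complex.exp (Complex.I * ((-n : ℤ) : ℂ) * t) * Complex.exp (Complex.I * n * t) = 1 := by
    rw [← Complex.exp_add, ← Complex.exp_zero]; congr 1; push_cast; ring
  simp at h0
  simp at he
  linear_combination Complex.exp (Complex.I * n * t) * h0 - (f : ℝ → ℂ) t * he

lemma aux_cos_e (C : Dom →ₗ[ℂ] Dom)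
    (hC : ∀ (ψ : Dom) (t : ℝ), (C ψ : ℝ → ℂ) t = (Real.cos t : ℂ) * (ψ : ℝ → ℂ) t) (n : ℤ) :
    C (auxe n) = (1 / 2 : ℂ) • auxe (n + 1) + (1 / 2 : ℂ) • auxe (n - 1) := by
  ext t
  rw [hC]
  simp only [Submodule.coe_add, Submodule.coe_smul, Pi.add_apply, Pi.smul_apply, smul_eq_mul,
    auxe_apply]
  have h1 : Complex.I * ((n + 1 : ℤ) : ℂ) * t = Complex.I * n * t + t * Complex.I := by
    push_cast; ring
  have h2 : Complex.I * ((n - 1 : ℤ) : ℂ) * t = Complex.I * n * t + -t * Complex.I := by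
    push_cast; ring
  rw [h1, h2, Complex.exp_add, Complex.exp_add, Complex.ofReal_cos, Complex.cos]
  ring

lemma aux_sin_e (S : Dom →ₗ[ℂ] Dom)
    (hS : ∀ (ψ : Dom) (t : ℝ), (S ψ : ℝ → ℂ) t = (Real.sin t : ℂ) * (ψ : ℝ → ℂ) t) (n : ℤ) :
    S (auxe n) = (-Complex.I / 2 : ℂ) • auxe (n + 1) + (Complex.I / 2 : ℂ) • auxe (n - 1) := by
  ext t
  rw [hS]
  simp only [Submodule.coe_add, Submodule.coe_smul, Pi.add_apply, Pi.smul_apply, smul_eq_mul,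
    auxe_apply]
  have h1 : Complex.I * ((n + 1 : ℤ) : ℂ) * t = Complex.I * n * t + t * Complex.I := by
    push_cast; ring
  have h2 : Complex.I * ((n - 1 : ℤ) : ℂ) * t = Complex.I * n * t + -t * Complex.I := by
    push_cast; ring
  rw [h1, h2, Complex.exp_add, Complex.exp_add, Complex.ofReal_sin, Complex.sin]
  ring

lemma aux_main (α ν : ℝ) (L A C S G H : Dom →ₗ[ℂ] Dom) (a : ℤ → ℂ)
    (hA : ∀ n, A (auxe n) = a n • auxe n)
    (hL : ∀ n : ℤ, L (auxe n) = ((n : ℂ) + ν) • auxe n)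
    (hC : ∀ n, C (auxe n) = (1 / 2 : ℂ) • auxe (n + 1) + (1 / 2 : ℂ) • auxe (n - 1))
    (hS : ∀ n, S (auxe n) =
      (-Complex.I / 2 : ℂ) • auxe (n + 1) + (Complex.I / 2 : ℂ) • auxe (n - 1))
    (hH : ∀ ψ, (-3 : ℂ) • H ψ = Complex.I • (A (C ψ) - C (A ψ)))
    (hG : ∀ ψ, (3 : ℂ) • G ψ = Complex.I • (A (S ψ) - S (A ψ)))
    (h4 : ∀ ψ, Complex.I • (G (S ψ) - S (G ψ)) - Complex.I • (H (C ψ) - C (H ψ))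
      = (2 : ℂ) • L ψ + (2 * α : ℂ) • ψ)
    (h5 : ∀ ψ, Complex.I • (G (H ψ) - H (G ψ)) = (2 : ℂ) • A ψ + (4 * α ^ 2 : ℂ) • L ψ)
    (n : ℤ) :
    a n = ((n : ℂ) + ν) ^ 3 + 3 * α * ((n : ℂ) + ν) ^ 2 + (1 / 2) * ((n : ℂ) + ν) + α / 2 := by
  have hI : Complex.I ^ 2 = -1 := Complex.I_sq
  have hGe : ∀ n, G (auxe n) = ((a (n + 1) - a n) / 6) • auxe (n + 1)
      + ((a n - a (n - 1)) / 6) • auxe (n - 1) := by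
    intro n
    have h := hG (auxe n)
    have h' : G (auxe n) = (1 / 3 : ℂ) • ((3 : ℂ) • G (auxe n)) := by
      rw [smul_smul]; norm_num
    rw [h', h]
    simp only [hS, hA, map_add, map_smul]
    match_scalars <;> ring_nf <;> simp only [hI] <;> ring
  have hHe : ∀ n, H (auxe n) = (-Complex.I * (a (n + 1) - a n) / 6) • auxe (n + 1)
      + (Complex.I * (a n - a (n - 1)) / 6) • auxe (n - 1) := by
    intro n
    have h := hH (auxe n)
    have h' : H (auxe n) = (-1 / 3 : ℂ) • ((-3 : ℂ) • H (auxe n)) := by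
      rw [smul_smul]; norm_num
    rw [h', h]
    simp only [hC, hA, map_add, map_smul]
    match_scalars <;> ring
  have ev : ∀ n, (auxe n : ℝ → ℂ) 0 = 1 := by intro n; simp [auxe_apply]
  have i1 : ∀ n : ℤ, n + 1 - 1 = n := fun n => by ring
  have i2 : ∀ n : ℤ, n - 1 + 1 = n := fun n => by ring
  have e4 : ∀ n : ℤ, a (n + 1) - 2 * a n + a (n - 1) = 6 * (n + ν + α) := by
    intro n
    have h := h4 (auxe n)
    simp only [hS, hC, hGe, hHe, hL, map_add, map_smul, i1, i2] at h
    have h0 := congrArg (fun f : Dom => (f : ℝ → ℂ) 0) h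
    simp only [Submodule.coe_add, Submodule.coe_sub, Submodule.coe_smul, Pi.add_apply,
      Pi.sub_apply, Pi.smul_apply, smul_eq_mul, ev] at h0
    ring_nf at h0 ⊢
    simp only [hI] at h0
    linear_combination 3 * h0
  have e5 : ∀ n : ℤ, (a (n + 1) - a n) ^ 2 - (a n - a (n - 1)) ^ 2
      = 36 * (a n + 2 * α ^ 2 * (n + ν)) := by
    intro n
    have h := h5 (auxe n)
    simp only [hA, hGe, hHe, hL, map_add, map_smul, i1, i2] at h
    have h0 := congrArg (fun f : Dom => (f : ℝ → ℂ) 0) h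
    simp only [Submodule.coe_add, Submodule.coe_sub, Submodule.coe_smul, Pi.add_apply,
      Pi.sub_apply, Pi.smul_apply, smul_eq_mul, ev] at h0
    ring_nf at h0 ⊢
    simp only [hI] at h0
    linear_combination 18 * h0
  have f1 := e4 n
  have f2 := e4 (n + 1)
  have g1 := e5 n
  have g2 := e5 (n + 1)
  rw [i1] at f2 g2
  push_cast at f2 g2
  generalize a (n + 1 + 1) = a2 at *
  generalize a (n + 1) = a1 at *
  generalize a (n - 1) = a0 at *
  generalize a n = b at *
  have hk : a1 - b = 3 * (n + ν + α : ℂ) ^ 2 + 3 * (n + ν + α) + 3 / 2 - 3 * α ^ 2 := by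
    have a0e : a0 = 6 * (n + ν + α) + 2 * b - a1 := by linear_combination f1
    have a2e : a2 = 6 * (n + 1 + ν + α) + 2 * a1 - b := by linear_combination f2
    subst a0e a2e
    linear_combination (g1 - g2) / 24
  have a0e : a0 = 6 * (n + ν + α) + 2 * b - a1 := by linear_combination f1
  have a1e : a1 = b + (3 * (n + ν + α : ℂ) ^ 2 + 3 * (n + ν + α) + 3 / 2 - 3 * α ^ 2) := by
    linear_combination hk
  subst a0e a1e
  linear_combination (-1 / 36) * g1

lemma aux_real_smul (r : ℝ) (T : Dom →ₗ[ℂ] Dom) : r • T = (r : ℂ) • T := by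
  ext ψ t
  simp

lemma aux_symm_comp {A B : Dom →ₗ[ℂ] Dom} (hA : SymmetricOp A) (hB : SymmetricOp B)
    (φ ψ : Dom) : ip (A (B φ) : ℝ → ℂ) (ψ : ℝ → ℂ) = ip (φ : ℝ → ℂ) (B (A ψ) : ℝ → ℂ) := by
  rw [hA, hB]

lemma aux_ip_add (φ ψ χ : Dom) : ip (φ : ℝ → ℂ) ((ψ + χ : Dom) : ℝ → ℂ)
    = ip (φ : ℝ → ℂ) (ψ : ℝ → ℂ) + ip (φ : ℝ → ℂ) (χ : ℝ → ℂ) := by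
  unfold ip
  have h1 := φ.2.1.continuous
  have h2 := ψ.2.1.continuous
  have h3 := χ.2.1.continuous
  rw [← intervalIntegral.integral_add]
  · simp only [Submodule.coe_add, Pi.add_apply, mul_add]
  · exact ((Complex.continuous_conj.comp h1).mul h2).intervalIntegrable _ _
  · exact ((Complex.continuous_conj.comp h1).mul h3).intervalIntegrable _ _

lemma aux_ip_smul (φ ψ : Dom) (c : ℂ) : ip (φ : ℝ → ℂ) ((c • ψ : Dom) : ℝ → ℂ)
    = c * ip (φ : ℝ → ℂ) (ψ : ℝ → ℂ) := by
  unfold ip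
  rw [← intervalIntegral.integral_const_mul]
  congr 1
  funext t
  simp only [Submodule.coe_smul, Pi.smul_apply, smul_eq_mul]
  ring

lemma aux_ip_smul_left (φ ψ : Dom) (c : ℂ) : ip ((c • φ : Dom) : ℝ → ℂ) (ψ : ℝ → ℂ)
    = (starRingEnd ℂ) c * ip (φ : ℝ → ℂ) (ψ : ℝ → ℂ) := by
  unfold ip
  rw [← intervalIntegral.integral_const_mul]
  congr 1
  funext t
  simp only [Submodule.coe_smul, Pi.smul_apply, smul_eq_mul, map_mul]
  ring

/-- Sharpened Von Neumann rule on `V_α`: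
`Q(ℓ³ + 3αℓ²) = Q(ℓ)³ + 3α Q(ℓ)² + (1/2) Q(ℓ) + (α/2) I`. -/
theorem stmt13 (α ν : ℝ) (Q : V α →ₗ[ℝ] (Dom →ₗ[ℂ] Dom)) (hQ : IsQuant (V α) ν Q)
    (h3 : fcube α ∈ V α) :
    Q ⟨fcube α, h3⟩ =
      Q ⟨fell, fell_mem_V α⟩ ∘ₗ Q ⟨fell, fell_mem_V α⟩ ∘ₗ Q ⟨fell, fell_mem_V α⟩ +
        ((3 * α : ℝ) : ℂ) • (Q ⟨fell, fell_mem_V α⟩ ∘ₗ Q ⟨fell, fell_mem_V α⟩) +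
        (1 / 2 : ℂ) • Q ⟨fell, fell_mem_V α⟩ +
        ((α : ℂ) / 2) • (LinearMap.id : Dom →ₗ[ℂ] Dom) := by
  have hL := hQ.map_ell (fell_mem_V α)
  have hC := hQ.map_cos (fcos_mem_V α)
  have hS := hQ.map_sin (fsin_mem_V α)
  have sL := hQ.symm ⟨fell, fell_mem_V α⟩
  have sA := hQ.symm ⟨fcube α, h3⟩
  obtain ⟨mc, ms⟩ := auxg_mem α
  have b1 := hQ.map_bracket ⟨fcube α, h3⟩ ⟨fell, fell_mem_V α⟩ (aux_pb_mem h3 (fell_mem_V α))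
  have b2 := hQ.map_bracket ⟨fcube α, h3⟩ ⟨fcos, fcos_mem_V α⟩ (aux_pb_mem h3 (fcos_mem_V α))
  have b3 := hQ.map_bracket ⟨fcube α, h3⟩ ⟨fsin, fsin_mem_V α⟩ (aux_pb_mem h3 (fsin_mem_V α))
  have b4 := hQ.map_bracket ⟨auxgc α, mc⟩ ⟨fsin, fsin_mem_V α⟩ (aux_pb_mem mc (fsin_mem_V α))
  have b4' := hQ.map_bracket ⟨auxgs α, ms⟩ ⟨fcos, fcos_mem_V α⟩ (aux_pb_mem ms (fcos_mem_V α))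
  have b5 := hQ.map_bracket ⟨auxgc α, mc⟩ ⟨auxgs α, ms⟩ (aux_pb_mem mc ms)
  have q1 : (⟨_, aux_pb_mem h3 (fell_mem_V α)⟩ : V α) = 0 := Subtype.ext (aux_b1 α)
  have q2 : (⟨_, aux_pb_mem h3 (fcos_mem_V α)⟩ : V α) = (-3 : ℝ) • ⟨auxgs α, ms⟩ :=
    Subtype.ext (aux_b2 α)
  have q3 : (⟨_, aux_pb_mem h3 (fsin_mem_V α)⟩ : V α) = (3 : ℝ) • ⟨auxgc α, mc⟩ :=
    Subtype.ext (aux_b3 α)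
  have q4 : (⟨_, aux_pb_mem mc (fsin_mem_V α)⟩ : V α) - ⟨_, aux_pb_mem ms (fcos_mem_V α)⟩
      = (2 : ℝ) • ⟨fell, fell_mem_V α⟩ + (2 * α) • ⟨fone, fone_mem_V α⟩ :=
    Subtype.ext (aux_b4 α)
  have q5 : (⟨_, aux_pb_mem mc ms⟩ : V α)
      = (2 : ℝ) • ⟨fcube α, h3⟩ + (4 * α ^ 2) • ⟨fell, fell_mem_V α⟩ :=
    Subtype.ext (aux_b5 α)
  have b4s := congrArg Q q4
  rw [map_sub, b4, b4', map_add, map_smul, map_smul, hQ.map_one, aux_real_smul,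
    aux_real_smul] at b4s
  rw [q1, map_zero] at b1
  rw [q2, map_smul, aux_real_smul] at b2
  rw [q3, map_smul, aux_real_smul] at b3
  rw [q5, map_add, map_smul, map_smul, aux_real_smul, aux_real_smul] at b5
  generalize Q ⟨fcube α, h3⟩ = A at *
  generalize Q ⟨fell, fell_mem_V α⟩ = L at *
  generalize Q ⟨fcos, fcos_mem_V α⟩ = C at *
  generalize Q ⟨fsin, fsin_mem_V α⟩ = S at *
  generalize Q ⟨auxgc α, mc⟩ = G at *
  generalize Q ⟨auxgs α, ms⟩ = H at *
  have hLe : ∀ n : ℤ, L (auxe n) = ((n : ℂ) + ν) • auxe n := by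
    intro n
    ext t
    rw [hL, (auxe_hasDeriv n t).deriv]
    simp only [Submodule.coe_smul, Pi.smul_apply, smul_eq_mul]
    linear_combination (-(n : ℂ) * (auxe n : ℝ → ℂ) t) * Complex.I_mul_I
  have hcomm : ∀ ψ, A (L ψ) = L (A ψ) := by
    intro ψ
    have := (smul_eq_zero.mp b1.symm).resolve_left Complex.I_ne_zero
    have := congrArg (fun T : Dom →ₗ[ℂ] Dom => T ψ) this
    exact sub_eq_zero.mp this
  choose a ha using aux_eigen L A ν hL hLe hcomm
  have key := aux_main α ν L A C S G H a ha hLe (aux_cos_e C hC) (aux_sin_e S hS)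
    (fun ψ => by simpa [-neg_smul] using congrArg (fun T : Dom →ₗ[ℂ] Dom => T ψ) b2)
    (fun ψ => by simpa using congrArg (fun T : Dom →ₗ[ℂ] Dom => T ψ) b3)
    (fun ψ => by simpa using congrArg (fun T : Dom →ₗ[ℂ] Dom => T ψ) b4s)
    (fun ψ => by simpa using congrArg (fun T : Dom →ₗ[ℂ] Dom => T ψ) b5.symm)
  refine LinearMap.ext fun ψ => ?_
  rw [← sub_eq_zero]
  apply aux_complete
  intro n
  have hneg : ∀ x y : Dom, x - y = x + (-1 : ℂ) • y := fun x y => by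
    module
  rw [hneg]
  simp only [LinearMap.add_apply, LinearMap.smul_apply, LinearMap.comp_apply, LinearMap.id_apply,
    aux_ip_add, aux_ip_smul]
  simp only [← sA (auxe n), ← sL (auxe n), ← sL (L (auxe n)), ← sL (L (L (auxe n)))]
  simp only [ha, hLe, map_smul, aux_ip_smul_left, key]
  have c2 : (starRingEnd ℂ) 2 = 2 := Complex.conj_ofNat 2
  have c3 : (starRingEnd ℂ) 3 = 3 := Complex.conj_ofNat 3
  simp [c2, c3]
  ring
end
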